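/- Let K/k be a finite Galois extension of fields with Galois group Γ, and let A be a finite-dimensional k-algebra. Then H^1(Γ, (A ⊗_k K)^×) is trivial, where Γ acts on A ⊗_k K through the second factor. -/

import Mathlib

/-! Nonabelian first group cohomology. -/

section NonabelianH1

variable (G A : Type*) [Group G] [Group A] [MulDistribMulAction G A]

/-- A 1-cocycle of `G` with values in the `G`-group `A`. -/
def IsCocycle (α : G → A) : Prop := ∀ h g : G, α (h * g) = α h * h • α g

/-- The set of 1-cocycles. -/
def Cocycle := {α : G → A // IsCocycle G A α}

variable {G A}

/-- Two cocycles are cohomologous if they differ by a coboundary. -/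
def Cohomologous (α β : Cocycle G A) : Prop :=
  ∃ a : A, ∀ g : G, α.1 g = a⁻¹ * β.1 g * g • a

variable (G A)

/-- Nonabelian first cohomology: cocycles modulo coboundaries. -/
def H1 := Quot (Cohomologous (G := G) (A := A))

/-- The class of a cocycle. -/
def H1.mk (α : Cocycle G A) : H1 G A := Quot.mk _ α

/-- The trivial (constant `1`) cocycle. -/
def trivialCocycle : Cocycle G A := ⟨fun _ => 1, fun _ _ => by simp⟩

/-- The distinguished point of `H1 G A`. -/
def H1.one : H1 G A := H1.mk G A (trivialCocycle G A)

variable {G A}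

/-- The map on `H1` induced by a `G`-equivariant group homomorphism. -/
def H1.map {B : Type*} [Group B] [MulDistribMulAction G B]
    (f : A →* B) (hf : ∀ (g : G) (a : A), f (g • a) = g • f a) :
    H1 G A → H1 G B :=
  Quot.map
    (fun α => ⟨fun g => f (α.1 g), by
      intro h g
      show f (α.1 (h * g)) = f (α.1 h) * h • f (α.1 g)
      rw [α.2 h g, map_mul, hf]⟩)
    (by
      rintro α β ⟨a, ha⟩
      refine ⟨f a, fun g => ?_⟩
      show f (α.1 g) = (f a)⁻¹ * f (β.1 g) * g • f a
      rw [ha g, map_mul, map_mul, map_inv, hf])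

/-- The map on `H1` induced by restriction along `r : G' →* G` together with an
`r`-equivariant homomorphism of coefficients. -/
def H1.mapRes {G' : Type*} [Group G'] (r : G' →* G)
    {B : Type*} [Group B] [MulDistribMulAction G' B]
    (f : A →* B) (hf : ∀ (g : G') (a : A), f (r g • a) = g • f a) :
    H1 G A → H1 G' B :=
  Quot.map
    (fun α => ⟨fun g => f (α.1 (r g)), by
      intro h g
      show f (α.1 (r (h * g))) = f (α.1 (r h)) * h • f (α.1 (r g))
      rw [map_mul r, α.2 (r h) (r g), map_mul, hf]⟩)
    (by
      rintro α β ⟨a, ha⟩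
      refine ⟨f a, fun g => ?_⟩
      show f (α.1 (r g)) = (f a)⁻¹ * f (β.1 (r g)) * g • f a
      rw [ha (r g), map_mul, map_mul, map_inv, hf])

/-- Multiplication on `H1` with commutative coefficients. -/
def H1.mul {G A : Type*} [Group G] [CommGroup A] [MulDistribMulAction G A] :
    H1 G A → H1 G A → H1 G A :=
  Quot.map₂
    (fun α β => ⟨fun g => α.1 g * β.1 g, by
      intro h g
      show α.1 (h * g) * β.1 (h * g) = α.1 h * β.1 h * h • (α.1 g * β.1 g)
      rw [α.2 h g, β.2 h g, smul_mul']
      exact mul_mul_mul_comm _ _ _ _⟩)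
    (by
      rintro α β γ ⟨a, ha⟩
      refine ⟨a, fun g => ?_⟩
      show α.1 g * β.1 g = a⁻¹ * (α.1 g * γ.1 g) * g • a
      rw [ha g]
      ac_rfl)
    (by
      rintro α β γ ⟨a, ha⟩
      refine ⟨a, fun g => ?_⟩
      show α.1 g * γ.1 g = a⁻¹ * (β.1 g * γ.1 g) * g • a
      rw [ha g]
      ac_rfl)

end NonabelianH1

/-! Galois descent for semilinear representations, and units among the invariants of a twisted
form of a finite-dimensional algebra. -/

namespace Representation

section Semilinear

variable {k K M : Type*} [Field k] [Field K] [Algebra k K] [AddCommGroup M] [Module k M]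
  [Module K M]

/-- A representation of `Gal(K/k)` on a `K`-vector space is semilinear if `Gal(K/k)` acts
compatibly with its action on scalars. -/
def IsSemilinear (ρ : Representation k (K ≃ₐ[k] K) M) : Prop :=
  ∀ (σ : K ≃ₐ[k] K) (c : K) (m : M), ρ σ (c • m) = σ c • ρ σ m

variable [FiniteDimensional k K] {ρ : Representation k (K ≃ₐ[k] K) M}

theorem span_range_apply_algEquiv_eq_top :
    Submodule.span K (Set.range fun (c : K) (σ : K ≃ₐ[k] K) => σ c) = ⊤ := by
  classical
  by_contra h
  obtain ⟨f, hf, hle⟩ := Submodule.exists_le_ker_of_lt_top _ (lt_top_iff_ne_top.2 h)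
  refine hf (LinearMap.pi_ext' fun σ => LinearMap.ext_ring ?_)
  have hindep : LinearIndependent K fun (σ : K ≃ₐ[k] K) => (σ : K → K) :=
    (linearIndependent_monoidHom K K).comp (fun σ : K ≃ₐ[k] K => (σ : K →* K))
      fun σ τ h => AlgEquiv.ext fun x => DFunLike.congr_fun h x
  refine Fintype.linearIndependent_iff.1 hindep (fun σ => f (Pi.single σ 1)) ?_ σ
  ext c
  have hc : f (fun σ : K ≃ₐ[k] K => σ c) = 0 := hle (Submodule.subset_span ⟨c, rfl⟩)
  rw [LinearMap.pi_apply_eq_sum_univ f] at hc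
  simp only [Finset.sum_apply, Pi.smul_apply, smul_eq_mul, Pi.zero_apply]
  rw [← hc]
  refine Finset.sum_congr rfl fun τ _ => (mul_comm _ _).trans (congrArg (τ c * f ·) ?_)
  ext g
  simp [Pi.single_apply, eq_comm]

/-- Galois descent: a stable subspace of a semilinear representation is spanned by its
invariants. -/
theorem IsSemilinear.span_invariants_inf (hρ : ρ.IsSemilinear) (N : Submodule K M)
    (hN : ∀ σ, ∀ m ∈ N, ρ σ m ∈ N) :
    Submodule.span K {m | m ∈ ρ.invariants ∧ m ∈ N} = N := by
  classical
  refine le_antisymm (Submodule.span_le.2 fun m hm => hm.2) fun w hw => ?_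
  set L : ((K ≃ₐ[k] K) → K) →ₗ[K] M := Fintype.linearCombination K fun σ => ρ σ w with hL
  have hrange : LinearMap.range L ≤ Submodule.span K {m | m ∈ ρ.invariants ∧ m ∈ N} := by
    rw [LinearMap.range_eq_map, ← span_range_apply_algEquiv_eq_top (k := k), Submodule.map_span,
      Submodule.span_le]
    rintro _ ⟨_, ⟨c, rfl⟩, rfl⟩
    have hnorm : L (fun σ => σ c) = ρ.norm (c • w) := by
      simp [hL, Fintype.linearCombination_apply, norm, hρ _ c w]
    refine Submodule.subset_span ⟨?_, ?_⟩
    · rw [hnorm]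
      exact fun g => ρ.self_norm_apply g _
    · exact N.sum_mem fun σ _ => N.smul_mem _ (hN σ w hw)
  refine hrange ⟨Pi.single 1 1, ?_⟩
  simp [hL, Fintype.linearCombination_apply_single]

variable [IsGalois k K] [IsScalarTower k K M]

/-- Invariant vectors that are independent over the base field are independent over the
extension. -/
theorem IsSemilinear.linearIndependent (hρ : ρ.IsSemilinear) {ι : Type*} {v : ι → M}
    (hv : ∀ i, v i ∈ ρ.invariants) (h : LinearIndependent k v) : LinearIndependent K v := by
  rw [linearIndependent_iff'] at h ⊢
  intro s g hg i hi
  refine (traceForm_nondegenerate k K).1 (g i) fun c => ?_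
  refine h s (fun i => Algebra.traceForm k K (g i) c) ?_ i hi
  have hnorm : ρ.norm (c • ∑ i ∈ s, g i • v i) = 0 := by rw [hg]; simp
  rw [← hnorm, Finset.smul_sum, map_sum]
  refine Finset.sum_congr rfl fun i _ => ?_
  rw [Algebra.traceForm_apply, ← algebraMap_smul K, trace_eq_sum_automorphisms, Finset.sum_smul,
    norm, LinearMap.sum_apply]
  refine Finset.sum_congr rfl fun σ _ => ?_
  rw [smul_smul, hρ, hv i σ, mul_comm c]

theorem IsSemilinear.finrank_invariants_inf [FiniteDimensional K M] (hρ : ρ.IsSemilinear)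
    (N : Submodule K M) (hN : ∀ σ, ∀ m ∈ N, ρ σ m ∈ N) :
    Module.finrank k ↥(ρ.invariants ⊓ N.restrictScalars k) = Module.finrank K N := by
  have : FiniteDimensional k M := .trans k K M
  set V := ρ.invariants ⊓ N.restrictScalars k
  let b := Module.finBasis k V
  have hb : LinearIndependent k fun i => (b i : M) :=
    b.linearIndependent.map' V.subtype V.ker_subtype
  have hK := hρ.linearIndependent (fun i => (b i).2.1) hb
  have hspan : Submodule.span K (Set.range fun i => (b i : M)) = N := by
    refine le_antisymm ?_ ?_
    · rw [Submodule.span_le]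
      rintro _ ⟨i, rfl⟩
      exact (b i).2.2
    · conv_lhs => rw [← hρ.span_invariants_inf N hN]
      rw [Submodule.span_le]
      intro m hm
      have hV : V ≤ (Submodule.span K (Set.range fun i => (b i : M))).restrictScalars k := by
        intro x hx
        have hsum : ∑ i, V.subtype (b.repr ⟨x, hx⟩ i • b i) = x := by
          rw [← map_sum, b.sum_repr, V.subtype_apply]
        rw [← hsum]
        exact Submodule.sum_mem _ fun i _ =>
          Submodule.smul_mem _ (b.repr ⟨x, hx⟩ i) (Submodule.subset_span ⟨i, rfl⟩)
      exact hV (x := m) hm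
  have := finrank_span_eq_card hK
  rw [hspan] at this
  simpa using this.symm

end Semilinear

end Representation

theorem Nat.card_le_eq_add_sum {X P : Type*} [Finite X] [Fintype P] [PartialOrder P]
    [DecidableLT P] (f : X → P) (p : P) :
    Nat.card {x // p ≤ f x} =
      Nat.card {x // f x = p} + ∑ q with p < q, Nat.card {x // f x = q} := by
  classical
  have := Fintype.ofFinite X
  simp only [Nat.card_eq_fintype_card, Fintype.card_subtype]
  have hsplit : (Finset.univ.filter fun z => p ≤ f z) =
      (Finset.univ.filter fun z => f z = p) ∪ (Finset.univ.filter fun z => p < f z) := by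
    ext z
    simp [le_iff_eq_or_lt, eq_comm]
  rw [hsplit, Finset.card_union_of_disjoint]
  · congr 1
    rw [Finset.card_eq_sum_card_fiberwise (f := f) (t := Finset.univ.filter fun q => p < q)
      fun z hz => by simpa using hz]
    refine Finset.sum_congr rfl fun q hq => congrArg Finset.card ?_
    ext z
    simp only [Finset.mem_filter, Finset.mem_univ, true_and] at hq ⊢
    exact ⟨And.right, fun hz => ⟨hz ▸ hq, hz⟩⟩
  · exact Finset.disjoint_filter.2 fun z _ hz hlt => hlt.ne' hz

/-- Two finite families in a finite partial order whose upper sets have equal counts have equal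
fibre counts. -/
theorem Nat.card_fiber_eq_of_card_le_eq {X Y P : Type*} [Finite X] [Finite Y] [Finite P]
    [PartialOrder P] (f : X → P) (g : Y → P)
    (h : ∀ p, Nat.card {x // p ≤ f x} = Nat.card {y // p ≤ g y}) (p : P) :
    Nat.card {x // f x = p} = Nat.card {y // g y = p} := by
  classical
  have := Fintype.ofFinite P
  induction p using WellFoundedGT.induction with
  | _ p ih =>
    have hp := h p
    rw [card_le_eq_add_sum, card_le_eq_add_sum,
      Finset.sum_congr rfl fun q hq => ih q (by simpa using hq)] at hp
    exact Nat.add_right_cancel hp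

theorem isUnit_of_forall_mul_eq_zero {K B : Type*} [Field K] [Ring B] [Algebra K B]
    [FiniteDimensional K B] {v : B} (hv : ∀ b, v * b = 0 → b = 0) : IsUnit v := by
  have hinj : Function.Injective (LinearMap.mulLeft K v) :=
    (injective_iff_map_eq_zero _).2 hv
  obtain ⟨w, hw : v * w = 1⟩ := LinearMap.injective_iff_surjective.1 hinj 1
  have hwv : w * v = 1 := hinj (by simp [← mul_assoc, hw])
  exact ⟨⟨v, w, hw, hwv⟩, rfl⟩

/-- Over an infinite subfield `k` of `K`, a `k`-subspace of a finite-dimensional `K`-algebra which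
spans it over `K` contains a unit. -/
theorem exists_isUnit_mem_of_span_eq_top {k K B : Type*} [Field k] [Infinite k] [Field K]
    [Algebra k K] [Ring B] [Algebra K B] [Module k B] [IsScalarTower k K B]
    [FiniteDimensional K B] (V : Submodule k B) (hV : Submodule.span K (V : Set B) = ⊤) :
    ∃ v ∈ V, IsUnit v := by
  obtain ⟨n, c, v, hcv⟩ :=
    Submodule.mem_span_set'.1 (hV ▸ Submodule.mem_top : (1 : B) ∈ Submodule.span K (V : Set B))
  let b := Module.finBasis K B
  let P : MvPolynomial (Fin n) K := Matrix.det
    (∑ i, (MvPolynomial.X i : MvPolynomial (Fin n) K) •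
      (Algebra.leftMulMatrix b (v i)).map MvPolynomial.C)
  have hP : ∀ x : Fin n → K,
      MvPolynomial.eval x P = (Algebra.leftMulMatrix b (∑ i, x i • (v i : B))).det := by
    intro x
    rw [RingHom.map_det]
    congr 1
    ext i j
    simp [Matrix.sum_apply]
  have hP0 : P ≠ 0 := by
    intro h0
    have := hP c
    rw [hcv, h0] at this
    simp at this
  have hinf : (Set.range (algebraMap k K)).Infinite :=
    Set.infinite_range_of_injective (algebraMap k K).injective
  obtain ⟨x, hx, hx0⟩ : ∃ x ∈ Set.pi Set.univ fun _ : Fin n => Set.range (algebraMap k K),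
      MvPolynomial.eval x P ≠ 0 := by
    by_contra! hcon
    exact hP0 (MvPolynomial.funext_set _ (fun _ => hinf) fun x hx => by simpa using hcon x hx)
  choose y hy using fun i => hx i trivial
  refine ⟨∑ i, y i • (v i : B), V.sum_mem fun i _ => V.smul_mem _ (v i).2, ?_⟩
  have hxy : ∑ i, y i • (v i : B) = ∑ i, x i • (v i : B) :=
    Finset.sum_congr rfl fun i _ => by rw [← hy i, algebraMap_smul]
  rw [hxy]
  rw [hP] at hx0
  refine isUnit_of_forall_mul_eq_zero (K := K) fun z hz => ?_
  have hmul := congrArg (Algebra.leftMulMatrix b) hz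
  rw [map_mul, map_zero] at hmul
  refine Algebra.leftMulMatrix_injective b ?_
  rw [map_zero]
  have hunit := (Matrix.isUnit_iff_isUnit_det _).2 hx0.isUnit
  exact (hunit.mul_right_eq_zero).1 hmul

section TwistedForm

variable {k K B : Type*} [Field k] [Field K] [Algebra k K] [FiniteDimensional k K] [IsGalois k K]
  [Ring B] [Algebra K B] [Module k B] [IsScalarTower k K B] [FiniteDimensional K B]

/-- For semilinear representations `ρ₀` by ring homomorphisms and `ρ` compatible with right
multiplication through `ρ₀`, the invariants of `ρ` contain a unit when `k` is finite. The proof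
counts the invariants of `ρ` and of `ρ₀` with a given annihilator among the invariants of `ρ₀`. -/
theorem exists_isUnit_mem_invariants_of_finite [Finite k]
    {ρ₀ ρ : Representation k (K ≃ₐ[k] K) B} (hρ₀ : ρ₀.IsSemilinear) (hρ : ρ.IsSemilinear)
    (hmul₀ : ∀ σ x y, ρ₀ σ (x * y) = ρ₀ σ x * ρ₀ σ y)
    (hmul : ∀ σ x y, ρ σ (x * y) = ρ σ x * ρ₀ σ y) (hone : 1 ∈ ρ₀.invariants) :
    ∃ v ∈ ρ.invariants, IsUnit v := by
  have : FiniteDimensional k B := .trans k K B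
  have : Finite B := Module.finite_of_finite k
  let N (S : Set ρ₀.invariants) : Submodule K B :=
    ⨅ b ∈ S, LinearMap.ker (LinearMap.mulRight K (b : B))
  have hmem (S : Set ρ₀.invariants) (x : B) : x ∈ N S ↔ ∀ b ∈ S, x * (b : B) = 0 := by
    simp [N, Submodule.mem_iInf]
  have hstable {τ : Representation k (K ≃ₐ[k] K) B}
      (hτ : ∀ σ x y, τ σ (x * y) = τ σ x * ρ₀ σ y) (S : Set ρ₀.invariants) (σ : K ≃ₐ[k] K) :
      ∀ x ∈ N S, τ σ x ∈ N S := by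
    intro x hx
    rw [hmem] at hx ⊢
    intro b hb
    rw [← b.2 σ, ← hτ, hx b hb, map_zero]
  let ann (x : B) : Set ρ₀.invariants := {b | x * (b : B) = 0}
  have hequiv (τ : Representation k (K ≃ₐ[k] K) B) (S : Set ρ₀.invariants) :
      Nat.card {x : τ.invariants // S ≤ ann x} =
        Nat.card ↥(τ.invariants ⊓ (N S).restrictScalars k) :=
    Nat.card_congr <| (Equiv.subtypeSubtypeEquivSubtypeInter (· ∈ τ.invariants) (S ≤ ann ·)).trans
      (Equiv.subtypeEquivRight fun x => and_congr_right fun _ => (hmem S x).symm)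
  have hfiber := Nat.card_fiber_eq_of_card_le_eq (fun x : ρ.invariants => ann x)
    (fun x : ρ₀.invariants => ann x) (fun S => by
      rw [hequiv, hequiv]
      refine Nat.card_congr (LinearEquiv.ofFinrankEq (R := k) _ _ ?_).toEquiv
      rw [hρ.finrank_invariants_inf _ (hstable hmul S),
        hρ₀.finrank_invariants_inf _ (hstable hmul₀ S)]) (ann 1)
  have : Nonempty {x : ρ₀.invariants // ann x = ann 1} := ⟨⟨⟨1, hone⟩, rfl⟩⟩
  obtain ⟨⟨v, hv⟩⟩ : Nonempty {x : ρ.invariants // ann x = ann 1} := by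
    rw [← Finite.card_pos_iff, hfiber, Finite.card_pos_iff]
    exact this
  refine ⟨v, v.2, isUnit_of_forall_mul_eq_zero (K := K) fun b hb => ?_⟩
  have hspan := hρ₀.span_invariants_inf (LinearMap.ker (LinearMap.mulLeft K (v : B)))
    fun σ x (hx : (v : B) * x = 0) => by
      change (v : B) * ρ₀ σ x = 0
      rw [← v.2 σ, ← hmul, hx, map_zero]
  have hzero : {m | m ∈ ρ₀.invariants ∧ m ∈ LinearMap.ker (LinearMap.mulLeft K (v : B))} ⊆
      {0} := by
    rintro m ⟨hm, hvm⟩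
    have : (⟨m, hm⟩ : ρ₀.invariants) ∈ ann 1 := hv ▸ (show (v : B) * m = 0 from hvm)
    simpa [ann] using this
  have hbot := (Submodule.span_mono (R := K) hzero).trans_eq (Submodule.span_zero_singleton K)
  rw [hspan] at hbot
  exact (Submodule.mem_bot K).1 (hbot hb)

theorem exists_isUnit_mem_invariants
    {ρ₀ ρ : Representation k (K ≃ₐ[k] K) B} (hρ₀ : ρ₀.IsSemilinear) (hρ : ρ.IsSemilinear)
    (hmul₀ : ∀ σ x y, ρ₀ σ (x * y) = ρ₀ σ x * ρ₀ σ y)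
    (hmul : ∀ σ x y, ρ σ (x * y) = ρ σ x * ρ₀ σ y) (hone : 1 ∈ ρ₀.invariants) :
    ∃ v ∈ ρ.invariants, IsUnit v := by
  cases finite_or_infinite k
  · exact exists_isUnit_mem_invariants_of_finite hρ₀ hρ hmul₀ hmul hone
  · refine exists_isUnit_mem_of_span_eq_top (K := K) ρ.invariants ?_
    exact (congrArg _ (Set.ext fun _ => (and_iff_left Submodule.mem_top).symm)).trans
      (hρ.span_invariants_inf ⊤ fun _ _ _ => Submodule.mem_top)

end TwistedForm

attribute [local instance] Algebra.TensorProduct.rightAlgebra in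
open TensorProduct in
/-- Every cocycle of `Gal(K/k)` in `(A ⊗[k] K)ˣ` is given by `σ ↦ v * (σ v)⁻¹`. -/
theorem exists_unit_forall_mul_map_eq {k K A : Type*} [Field k] [Field K] [Algebra k K]
    [FiniteDimensional k K] [IsGalois k K] [Ring A] [Algebra k A] [FiniteDimensional k A]
    (α : (K ≃ₐ[k] K) → A ⊗[k] K) (hα1 : α 1 = 1)
    (hα : ∀ σ τ, α (σ * τ) =
      α σ * Algebra.TensorProduct.map (AlgHom.id k A) σ.toAlgHom (α τ)) :
    ∃ v : (A ⊗[k] K)ˣ, ∀ σ : K ≃ₐ[k] K,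
      α σ * Algebra.TensorProduct.map (AlgHom.id k A) σ.toAlgHom v = v := by
  let φ (σ : K ≃ₐ[k] K) : A ⊗[k] K →ₐ[k] A ⊗[k] K :=
    Algebra.TensorProduct.map (AlgHom.id k A) σ.toAlgHom
  have hφ1 : φ 1 = AlgHom.id k _ := by
    ext <;> simp [φ]
  have hφmul (σ τ : K ≃ₐ[k] K) : φ (σ * τ) = (φ σ).comp (φ τ) := by
    ext <;> simp [φ]
  have hφsmul (σ : K ≃ₐ[k] K) (c : K) (x : A ⊗[k] K) : φ σ (c • x) = σ c • φ σ x := by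
    rw [Algebra.smul_def, Algebra.smul_def, map_mul]
    simp [φ, Algebra.TensorProduct.algebraMap_eq_includeRight]
  let ρ₀ : Representation k (K ≃ₐ[k] K) (A ⊗[k] K) :=
    { toFun := fun σ => (φ σ).toLinearMap
      map_one' := by rw [hφ1]; rfl
      map_mul' := fun σ τ => by rw [hφmul]; rfl }
  let ρ : Representation k (K ≃ₐ[k] K) (A ⊗[k] K) :=
    { toFun := fun σ => LinearMap.mulLeft k (α σ) ∘ₗ (φ σ).toLinearMap
      map_one' := by
        ext
        simp [hφ1, hα1]
      map_mul' := fun σ τ => LinearMap.ext fun x => by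
        change α (σ * τ) * φ (σ * τ) x = α σ * φ σ (α τ * φ τ x)
        rw [hα, hφmul, map_mul, mul_assoc]
        rfl }
  have : FiniteDimensional K (A ⊗[k] K) :=
    Module.Finite.of_restrictScalars_finite k K _
  obtain ⟨v, hv, u, rfl⟩ := exists_isUnit_mem_invariants (ρ₀ := ρ₀) (ρ := ρ) hφsmul
    (fun σ c x => by
      change α σ * φ σ (c • x) = σ c • (α σ * φ σ x)
      rw [hφsmul, mul_smul_comm])
    (fun σ => map_mul (φ σ)) (fun σ x y => by
      change α σ * φ σ (x * y) = α σ * φ σ x * φ σ y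
      rw [map_mul, mul_assoc]) (fun σ => map_one (φ σ))
  exact ⟨u, hv⟩

open TensorProduct in
/-- For a finite Galois extension `K/k` with Galois group `Γ = K ≃ₐ[k] K` and a
finite-dimensional `k`-algebra `A`, the nonabelian cohomology set `H¹(Γ, (A ⊗[k] K)ˣ)` is trivial,
where `Γ` acts on `A ⊗[k] K` through the second factor. -/
theorem statement_1 (k K A : Type*) [Field k] [Field K] [Algebra k K]
    [FiniteDimensional k K] [IsGalois k K]
    [Ring A] [Algebra k A] [FiniteDimensional k A]
    [MulDistribMulAction (K ≃ₐ[k] K) (A ⊗[k] K)ˣ]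
    (hact : ∀ (σ : K ≃ₐ[k] K) (u : (A ⊗[k] K)ˣ),
      ((σ • u : (A ⊗[k] K)ˣ) : A ⊗[k] K) =
        Algebra.TensorProduct.map (AlgHom.id k A) σ.toAlgHom (u : A ⊗[k] K)) :
    ∀ c : H1 (K ≃ₐ[k] K) (A ⊗[k] K)ˣ, c = H1.one _ _ := by
  rintro ⟨α, hα⟩
  have hα1 : α 1 = 1 := by simpa using hα 1 1
  obtain ⟨v, hv⟩ := exists_unit_forall_mul_map_eq (fun σ => (α σ : A ⊗[k] K)) (by simp [hα1])
    fun σ τ => by rw [hα σ τ, Units.val_mul, hact]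
  refine Quot.sound ⟨v⁻¹, fun σ => ?_⟩
  change α σ = v⁻¹⁻¹ * 1 * σ • v⁻¹
  have hσ : α σ * σ • v = v := Units.ext (by rw [Units.val_mul, hact, hv])
  rw [inv_inv, mul_one, smul_inv', eq_mul_inv_iff_mul_eq, hσ]
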